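/- arXiv:2501.18067 — 2 statements merged into one kernel-verified Lean document; each statement's English description precedes it below -/
import Mathlib

section
/- Let J be the superalgebra (2,2)₆₇. For every even supersymmetric 2-cocycle h : J × J → J there exists an even F-linear map μ : J → J with h(a,b) = aμ(b) + μ(a)b − μ(ab) for all a, b; that is, the even part of the second cohomology group H²(J,J) vanishes. -/
namespace JS22

variable (F : Type*) [Field F] [CharZero F]

/-- The underlying ℤ₂-graded vector space `J = F⁴`: coordinates `0,1` are the even
basis vectors `e₁, e₂` and coordinates `2,3` are the odd basis vectors `f₁, f₂`. -/
abbrev J : Type _ := Fin 4 → F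

def e1 : J F := ![1, 0, 0, 0]
def e2 : J F := ![0, 1, 0, 0]
def f1 : J F := ![0, 0, 1, 0]
def f2 : J F := ![0, 0, 0, 1]

/-- The even part `J₀ = span {e₁, e₂}`. -/
def J0 : Submodule F (J F) := Submodule.span F {e1 F, e2 F}

/-- The odd part `J₁ = span {f₁, f₂}`. -/
def J1 : Submodule F (J F) := Submodule.span F {f1 F, f2 F}

/-- `x` is homogeneous of degree `d ∈ {0, 1}`. -/
def IsHomog (x : J F) (d : ℕ) : Prop :=
  (d = 0 ∧ x ∈ J0 F) ∨ (d = 1 ∧ x ∈ J1 F)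

/-- A (bilinear) multiplication is supercommutative: `x y = (−1)^{|x||y|} y x`. -/
def IsSuperComm (mul : J F → J F → J F) : Prop :=
  ∀ x y : J F, ∀ dx dy : ℕ, IsHomog F x dx → IsHomog F y dy →
    mul x y = ((-1 : F) ^ (dx * dy)) • mul y x

/-- The Jordan superidentity, for all homogeneous `w, x, y, z`. -/
def SatisfiesJordanSuperId (mul : J F → J F → J F) : Prop :=
  ∀ w x y z : J F, ∀ dw dx dy dz : ℕ,
    IsHomog F w dw → IsHomog F x dx → IsHomog F y dy → IsHomog F z dz →
    mul (mul w x) (mul y z)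
      + ((-1 : F) ^ (dx * dy)) • mul (mul w y) (mul x z)
      + ((-1 : F) ^ ((dx + dy) * dz)) • mul (mul w z) (mul x y)
      - ((-1 : F) ^ (dw * dx)) • mul x (mul w (mul y z))
      - ((-1 : F) ^ (dy * (dw + dx))) • mul y (mul w (mul x z))
      - ((-1 : F) ^ (dz * (dw + dx + dy))) • mul z (mul w (mul x y)) = 0

/-- `F(a,b,c,d) = h((ab)c, d) + h(ab,c)·d + (h(a,b)·c)·d`. -/
def Fc (mul : J F → J F → J F) (h : J F →ₗ[F] J F →ₗ[F] J F) (a b c d : J F) : J F :=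
  h (mul (mul a b) c) d + mul (h (mul a b) c) d + mul (mul (h a b) c) d

/-- `G(a,b,c,d) = h(ab, cd) + h(a,b)·(cd) + (ab)·h(c,d)`. -/
def Gc (mul : J F → J F → J F) (h : J F →ₗ[F] J F →ₗ[F] J F) (a b c d : J F) : J F :=
  h (mul a b) (mul c d) + mul (h a b) (mul c d) + mul (mul a b) (h c d)

/-- Supersymmetry of `h`: `h(a,b) = (−1)^{|a||b|} h(b,a)` for homogeneous `a, b`. -/
def IsSuperSym (h : J F →ₗ[F] J F →ₗ[F] J F) : Prop :=
  ∀ a b : J F, ∀ da db : ℕ, IsHomog F a da → IsHomog F b db →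
    h a b = ((-1 : F) ^ (da * db)) • h b a

/-- The 2-cocycle identity for `h` with respect to the multiplication `mul`. -/
def IsCocycleId (mul : J F → J F → J F) (h : J F →ₗ[F] J F →ₗ[F] J F) : Prop :=
  ∀ a b c d : J F, ∀ da db dc dd : ℕ,
    IsHomog F a da → IsHomog F b db → IsHomog F c dc → IsHomog F d dd →
    Fc F mul h a b c d + ((-1 : F) ^ (db * (dc + dd) + dc * dd)) • Fc F mul h a d c b
      + ((-1 : F) ^ (da * (db + dc + dd) + dc * dd)) • Fc F mul h b d c a
    = Gc F mul h a b c d + ((-1 : F) ^ (db * dc)) • Gc F mul h a c b d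
      + ((-1 : F) ^ (dd * (dc + db))) • Gc F mul h a d b c

/-- `h` is a supersymmetric 2-cocycle. -/
def IsSuperCocycle (mul : J F → J F → J F) (h : J F →ₗ[F] J F →ₗ[F] J F) : Prop :=
  IsSuperSym F h ∧ IsCocycleId F mul h

/-- `h` is a coboundary: `h(a,b) = a·μ(b) + μ(a)·b − μ(a·b)` for some linear `μ`. -/
def IsCoboundary (mul : J F → J F → J F) (h : J F →ₗ[F] J F →ₗ[F] J F) : Prop :=
  ∃ μ : J F →ₗ[F] J F, ∀ a b : J F, h a b = mul a (μ b) + mul (μ a) b - μ (mul a b)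

/-- The bilinear map `h` is even: `h(J_i × J_j) ⊆ J_{i+j}`. -/
def IsEvenBilin (h : J F →ₗ[F] J F →ₗ[F] J F) : Prop :=
  (∀ a ∈ J0 F, ∀ b ∈ J0 F, h a b ∈ J0 F) ∧
  (∀ a ∈ J0 F, ∀ b ∈ J1 F, h a b ∈ J1 F) ∧
  (∀ a ∈ J1 F, ∀ b ∈ J0 F, h a b ∈ J1 F) ∧
  (∀ a ∈ J1 F, ∀ b ∈ J1 F, h a b ∈ J0 F)

/-- The linear map `μ` is even: `μ(J_i) ⊆ J_i`. -/
def IsEvenLin (μ : J F →ₗ[F] J F) : Prop :=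
  (∀ a ∈ J0 F, μ a ∈ J0 F) ∧ (∀ a ∈ J1 F, μ a ∈ J1 F)

/-- `φ` is a graded algebra isomorphism from `(J, mulA)` onto `(J, mulB)`. -/
def IsGradedIso (mulA mulB : J F → J F → J F) (φ : J F → J F) : Prop :=
  IsLinearMap F φ ∧ Function.Bijective φ ∧
  φ '' (J0 F : Set (J F)) = (J0 F : Set (J F)) ∧
  φ '' (J1 F : Set (J F)) = (J1 F : Set (J F)) ∧
  ∀ x y : J F, φ (mulA x y) = mulB (φ x) (φ y)

/-- `D_γ`: `e₁²=e₁`, `e₂²=e₂`, `eᵢfⱼ = ½fⱼ`, `f₁f₂ = e₁ + γe₂`. -/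
def mulD (γ : F) (x y : J F) : J F :=
  ![x 0 * y 0 + (x 2 * y 3 - x 3 * y 2),
    x 1 * y 1 + γ * (x 2 * y 3 - x 3 * y 2),
    ((x 0 + x 1) * y 2 + x 2 * (y 0 + y 1)) / 2,
    ((x 0 + x 1) * y 3 + x 3 * (y 0 + y 1)) / 2]

/-- `(2,2)₁`: `e₁²=e₁`, `e₂²=e₂`. -/
def mul1 (x y : J F) : J F :=
  ![x 0 * y 0, x 1 * y 1, 0, 0]

/-- `(2,2)₃`: `e₁²=e₁`, `e₂²=e₂`, `e₁f₁=½f₁`, `e₁f₂=½f₂`, `f₁f₂=e₁`. -/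
def mul3 (x y : J F) : J F :=
  ![x 0 * y 0 + (x 2 * y 3 - x 3 * y 2), x 1 * y 1,
    (x 0 * y 2 + x 2 * y 0) / 2, (x 0 * y 3 + x 3 * y 0) / 2]

/-- `(2,2)₅`: `e₁²=e₁`, `e₂²=e₂`, `e₁f₁=f₁`, `e₁f₂=f₂`, `f₁f₂=e₁`. -/
def mul5 (x y : J F) : J F :=
  ![x 0 * y 0 + (x 2 * y 3 - x 3 * y 2), x 1 * y 1,
    x 0 * y 2 + x 2 * y 0, x 0 * y 3 + x 3 * y 0]

/-- `(2,2)₇`: `e₁²=e₁`, `e₂²=e₂`, `eᵢfⱼ=½fⱼ`, `f₁f₂=e₂`. -/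
def mul7 (x y : J F) : J F :=
  ![x 0 * y 0, x 1 * y 1 + (x 2 * y 3 - x 3 * y 2),
    ((x 0 + x 1) * y 2 + x 2 * (y 0 + y 1)) / 2,
    ((x 0 + x 1) * y 3 + x 3 * (y 0 + y 1)) / 2]

/-- `(2,2)₈`: `e₁²=e₁`, `e₂²=e₂`, `e₁f₁=½f₁`. -/
def mul8 (x y : J F) : J F :=
  ![x 0 * y 0, x 1 * y 1, (x 0 * y 2 + x 2 * y 0) / 2, 0]

/-- `(2,2)₂₆`: `e₁²=e₁`, `e₁f₁=½f₁`, `e₁f₂=½f₂`, `f₁f₂=e₁+e₂`. -/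
def mul26 (x y : J F) : J F :=
  ![x 0 * y 0 + (x 2 * y 3 - x 3 * y 2), x 2 * y 3 - x 3 * y 2,
    (x 0 * y 2 + x 2 * y 0) / 2, (x 0 * y 3 + x 3 * y 0) / 2]

/-- `(2,2)₄₃`: `e₁²=e₁`, `e₁e₂=e₂`, `e₁f₁=f₁`, `e₁f₂=f₂`, `f₁f₂=e₁+e₂`. -/
def mul43 (x y : J F) : J F :=
  ![x 0 * y 0 + (x 2 * y 3 - x 3 * y 2),
    x 0 * y 1 + x 1 * y 0 + (x 2 * y 3 - x 3 * y 2),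
    x 0 * y 2 + x 2 * y 0, x 0 * y 3 + x 3 * y 0]

/-- `(2,2)₅₂`: `e₁²=e₁`, `e₁e₂=½e₂`. -/
def mul52 (x y : J F) : J F :=
  ![x 0 * y 0, (x 0 * y 1 + x 1 * y 0) / 2, 0, 0]

/-- `(2,2)₅₇`: `e₁²=e₁`, `e₁e₂=½e₂`, `e₁f₂=f₂`. -/
def mul57 (x y : J F) : J F :=
  ![x 0 * y 0, (x 0 * y 1 + x 1 * y 0) / 2, 0, x 0 * y 3 + x 3 * y 0]

/-- `(2,2)₆₀`: `e₁²=e₁`, `e₁e₂=½e₂`, `e₁f₁=½f₁`, `e₁f₂=½f₂`. -/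
def mul60 (x y : J F) : J F :=
  ![x 0 * y 0, (x 0 * y 1 + x 1 * y 0) / 2,
    (x 0 * y 2 + x 2 * y 0) / 2, (x 0 * y 3 + x 3 * y 0) / 2]

/-- `(2,2)₆₇`: `e₁²=e₁`, `e₁e₂=½e₂`, `e₁f₁=f₁`, `e₁f₂=f₂`. -/
def mul67 (x y : J F) : J F :=
  ![x 0 * y 0, (x 0 * y 1 + x 1 * y 0) / 2,
    x 0 * y 2 + x 2 * y 0, x 0 * y 3 + x 3 * y 0]


theorem mul67_add_left (x y z : J F) : mul67 F (x + y) z = mul67 F x z + mul67 F y z := by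
  ext i; fin_cases i <;> simp [mul67] <;> ring

theorem mul67_add_right (x y z : J F) : mul67 F x (y + z) = mul67 F x y + mul67 F x z := by
  ext i; fin_cases i <;> simp [mul67] <;> ring

theorem mul67_smul_left (c : F) (x z : J F) : mul67 F (c • x) z = c • mul67 F x z := by
  ext i; fin_cases i <;> simp [mul67] <;> ring

theorem mul67_smul_right (c : F) (x z : J F) : mul67 F x (c • z) = c • mul67 F x z := by
  ext i; fin_cases i <;> simp [mul67] <;> ring

theorem mul67_neg_left (x z : J F) : mul67 F (-x) z = -mul67 F x z := by
  ext i; fin_cases i <;> simp [mul67] <;> ring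

theorem mul67_zero_left (z : J F) : mul67 F 0 z = 0 := by
  ext i; fin_cases i <;> simp [mul67]

theorem mul67_zero_right (z : J F) : mul67 F z 0 = 0 := by
  ext i; fin_cases i <;> simp [mul67]

theorem mul67_table :
    mul67 F (e1 F) (e1 F) = e1 F ∧
    mul67 F (e1 F) (e2 F) = (1 / 2 : F) • e2 F ∧
    mul67 F (e1 F) (f1 F) = f1 F ∧
    mul67 F (e1 F) (f2 F) = f2 F ∧
    mul67 F (e2 F) (e1 F) = (1 / 2 : F) • e2 F ∧
    mul67 F (e2 F) (e2 F) = 0 ∧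
    mul67 F (e2 F) (f1 F) = 0 ∧
    mul67 F (e2 F) (f2 F) = 0 ∧
    mul67 F (f1 F) (e1 F) = f1 F ∧
    mul67 F (f1 F) (e2 F) = 0 ∧
    mul67 F (f1 F) (f1 F) = 0 ∧
    mul67 F (f1 F) (f2 F) = 0 ∧
    mul67 F (f2 F) (e1 F) = f2 F ∧
    mul67 F (f2 F) (e2 F) = 0 ∧
    mul67 F (f2 F) (f1 F) = 0 ∧
    mul67 F (f2 F) (f2 F) = 0 := by
  refine ⟨?_, ?_, ?_, ?_, ?_, ?_, ?_, ?_, ?_, ?_, ?_, ?_, ?_, ?_, ?_, ?_⟩ <;>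
    (ext i; fin_cases i <;> simp [mul67, e1, e2, f1, f2])

theorem decomp (x : J F) : x = x 0 • e1 F + x 1 • e2 F + x 2 • f1 F + x 3 • f2 F := by
  ext i; fin_cases i <;> simp [e1, e2, f1, f2]

/-- for `J = (2,2)₆₇`, every even supersymmetric 2-cocycle is the
coboundary of an even linear map, i.e. the even part of `H²(J,J)` vanishes. -/
theorem even_H2_vanishes_mul67 (h : J F →ₗ[F] J F →ₗ[F] J F)
    (hev : IsEvenBilin F h) (hc : IsSuperCocycle F (mul67 F) h) :
    ∃ μ : J F →ₗ[F] J F, IsEvenLin F μ ∧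
      ∀ a b : J F, h a b = mul67 F a (μ b) + mul67 F (μ a) b - μ (mul67 F a b) := by
  obtain ⟨h00, h01, h10, h11⟩ := hev
  obtain ⟨hs, hc⟩ := hc
  have me1 : e1 F ∈ J0 F := Submodule.subset_span (by simp)
  have me2 : e2 F ∈ J0 F := Submodule.subset_span (by simp)
  have mf1 : f1 F ∈ J1 F := Submodule.subset_span (by simp)
  have mf2 : f2 F ∈ J1 F := Submodule.subset_span (by simp)
  have de1 : IsHomog F (e1 F) 0 := Or.inl ⟨rfl, me1⟩
  have de2 : IsHomog F (e2 F) 0 := Or.inl ⟨rfl, me2⟩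
  have df1 : IsHomog F (f1 F) 1 := Or.inr ⟨rfl, mf1⟩
  have df2 : IsHomog F (f2 F) 1 := Or.inr ⟨rfl, mf2⟩
  obtain ⟨a00, b00, t00⟩ := Submodule.mem_span_pair.1 (h00 _ me1 _ me1)
  obtain ⟨a01, b01, t01⟩ := Submodule.mem_span_pair.1 (h00 _ me1 _ me2)
  obtain ⟨a02, b02, t02⟩ := Submodule.mem_span_pair.1 (h01 _ me1 _ mf1)
  obtain ⟨a03, b03, t03⟩ := Submodule.mem_span_pair.1 (h01 _ me1 _ mf2)
  obtain ⟨a11, b11, t11⟩ := Submodule.mem_span_pair.1 (h00 _ me2 _ me2)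
  obtain ⟨a12, b12, t12⟩ := Submodule.mem_span_pair.1 (h01 _ me2 _ mf1)
  obtain ⟨a13, b13, t13⟩ := Submodule.mem_span_pair.1 (h01 _ me2 _ mf2)
  obtain ⟨a23, b23, t23⟩ := Submodule.mem_span_pair.1 (h11 _ mf1 _ mf2)
  have t10 : h (e2 F) (e1 F) = h (e1 F) (e2 F) := by
    simpa using hs _ _ _ _ de2 de1
  have t20 : h (f1 F) (e1 F) = h (e1 F) (f1 F) := by
    simpa using hs _ _ _ _ df1 de1
  have t21 : h (f1 F) (e2 F) = h (e2 F) (f1 F) := by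
    simpa using hs _ _ _ _ df1 de2
  have t30 : h (f2 F) (e1 F) = h (e1 F) (f2 F) := by
    simpa using hs _ _ _ _ df2 de1
  have t31 : h (f2 F) (e2 F) = h (e2 F) (f2 F) := by
    simpa using hs _ _ _ _ df2 de2
  have t32 : h (f2 F) (f1 F) = -h (f1 F) (f2 F) := by
    simpa using hs _ _ _ _ df2 df1
  have t22 : h (f1 F) (f1 F) = 0 := by
    have := hs _ _ _ _ df1 df1
    simp only [mul_one, pow_one, neg_smul, one_smul] at this
    exact self_eq_neg.1 this
  have t33 : h (f2 F) (f2 F) = 0 := by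
    have := hs _ _ _ _ df2 df2
    simp only [mul_one, pow_one, neg_smul, one_smul] at this
    exact self_eq_neg.1 this
  obtain ⟨m00, m01, m02, m03, m10, m11, m12, m13, m20, m21, m22, m23, m30, m31, m32, m33⟩ := mul67_table F
  have q0000 := hc _ _ _ _ _ _ _ _ de1 de1 de1 de1
  have q0001 := hc _ _ _ _ _ _ _ _ de1 de1 de1 de2
  have q0002 := hc _ _ _ _ _ _ _ _ de1 de1 de1 df1
  have q0003 := hc _ _ _ _ _ _ _ _ de1 de1 de1 df2
  have q0012 := hc _ _ _ _ _ _ _ _ de1 de1 de2 df1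
  have q0013 := hc _ _ _ _ _ _ _ _ de1 de1 de2 df2
  have q0023 := hc _ _ _ _ _ _ _ _ de1 de1 df1 df2
  have q0101 := hc _ _ _ _ _ _ _ _ de1 de2 de1 de2
  have q0112 := hc _ _ _ _ _ _ _ _ de1 de2 de2 df1
  have q0123 := hc _ _ _ _ _ _ _ _ de1 de2 df1 df2
  simp only [Fc, Gc, m00, m01, m02, m03, m10, m11, m12, m13, m20, m21, m22, m23, m30, m31, m32, m33, mul67_add_left, mul67_add_right, mul67_smul_left, mul67_smul_right, mul67_zero_left, mul67_neg_left, mul67_zero_right, map_smul, map_zero, LinearMap.smul_apply, LinearMap.zero_apply, t10, t20, t21, t30, t31, t32, t22, t33, ← t00, ← t01, ← t02, ← t03, ← t11, ← t12, ← t13, ← t23, smul_neg, smul_zero, ← neg_smul] at q0000 q0001 q0002 q0003 q0012 q0013 q0023 q0101 q0112 q0123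
  have r00001 := congrFun q0000 1
  have r00011 := congrFun q0001 1
  have r00022 := congrFun q0002 2
  have r00023 := congrFun q0002 3
  have r00032 := congrFun q0003 2
  have r00033 := congrFun q0003 3
  have r00122 := congrFun q0012 2
  have r00123 := congrFun q0012 3
  have r00132 := congrFun q0013 2
  have r00133 := congrFun q0013 3
  have r00231 := congrFun q0023 1
  have r01011 := congrFun q0101 1
  have r01122 := congrFun q0112 2
  have r01231 := congrFun q0123 1
  simp [e1, e2, f1, f2] at r00001 r00011 r00022 r00023 r00032 r00033 r00122 r00123 r00132 r00133 r00231 r01011 r01122 r01231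
  clear q0000 q0001 q0002 q0003 q0012 q0013 q0023 q0101 q0112 q0123
  have z1 : b00 = 0 := by grind
  have z2 : b01 = a00 / 2 := by grind
  have z3 : a02 = a00 := by grind
  have z4 : b02 = 0 := by grind
  have z5 : a03 = 0 := by grind
  have z6 : b03 = a00 := by grind
  have z7 : a12 = 2 * a01 := by grind
  have z8 : b12 = 0 := by grind
  have z9 : a13 = 0 := by grind
  have z10 : b13 = 2 * a01 := by grind
  have z11 : b23 = 0 := by grind
  have z12 : b11 = 2 * a01 := by grind
  have z13 : a11 = 0 := by grind
  have z14 : a23 = 0 := by grind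
  clear r00001 r00011 r00022 r00023 r00032 r00033 r00122 r00123 r00132 r00133 r00231 r01011 r01122 r01231
  subst z1 z2 z3 z4 z5 z6 z7 z8 z9 z10 z11 z12 z13 z14
  refine ⟨(b03 • LinearMap.proj 0 + (2 * a01) • LinearMap.proj 1 : J F →ₗ[F] F).smulRight (e1 F), ⟨?_, ?_⟩, ?_⟩
  · intro a _
    exact Submodule.smul_mem _ _ me1
  · intro a ha
    obtain ⟨u, v, rfl⟩ := Submodule.mem_span_pair.1 ha
    simp [f1, f2]
  · intro x y
    have key : h x y = h (x 0 • e1 F + x 1 • e2 F + x 2 • f1 F + x 3 • f2 F)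
        (y 0 • e1 F + y 1 • e2 F + y 2 • f1 F + y 3 • f2 F) := by
      rw [← decomp, ← decomp]
    rw [key]
    simp only [map_add, map_smul, LinearMap.add_apply, LinearMap.smul_apply, t10, t20, t21, t30, t31, t32, t22, t33, ← t00, ← t01, ← t02, ← t03, ← t11, ← t12, ← t13, ← t23]
    ext i
    fin_cases i <;> simp [mul67, e1, e2, f1, f2] <;> ring

end JS22
end

section
/- For each t ∈ F let m_t be the supercommutative superalgebra structure on J determined by m_t(e₁,e₁) = e₁, m_t(e₂,e₂) = e₂, m_t(eᵢ,fⱼ) = ½fⱼ for i, j ∈ {1,2}, and m_t(f₁,f₂) = t·e₁ + e₂. Then: (i) m₀ is the multiplication of the superalgebra (2,2)₇; and (ii) for every t ≠ 0, the F-linear map φ with φ(e₁) = e₂, φ(e₂) = e₁, φ(f₁) = f₁, φ(f₂) = f₂ is a graded algebra isomorphism from (J, m_t) onto D_t. Hence the family (m_t) is a one-parameter degeneration of the family D_γ to (2,2)₇. -/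
namespace JS22

variable (F : Type*) [Field F] [CharZero F]

/-- The family `m_t`: `e₁²=e₁`, `e₂²=e₂`, `eᵢfⱼ=½fⱼ`, `f₁f₂ = t·e₁ + e₂`. -/
def mt12 (t : F) (x y : J F) : J F :=
  ![x 0 * y 0 + t * (x 2 * y 3 - x 3 * y 2),
    x 1 * y 1 + (x 2 * y 3 - x 3 * y 2),
    ((x 0 + x 1) * y 2 + x 2 * (y 0 + y 1)) / 2,
    ((x 0 + x 1) * y 3 + x 3 * (y 0 + y 1)) / 2]

/-- The linear map `φ`: `e₁ ↦ e₂`, `e₂ ↦ e₁`, `f₁ ↦ f₁`, `f₂ ↦ f₂`. -/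
def phi12 (x : J F) : J F := ![x 1, x 0, x 2, x 3]

theorem mem_J0_iff (x : J F) : x ∈ J0 F ↔ x 2 = 0 ∧ x 3 = 0 := by
  unfold J0
  rw [Submodule.mem_span_pair]
  constructor
  · rintro ⟨a, b, rfl⟩
    simp [e1, e2]
  · rintro ⟨h2, h3⟩
    refine ⟨x 0, x 1, ?_⟩
    ext i
    fin_cases i <;> simp [e1, e2, h2, h3]

theorem mem_J1_iff (x : J F) : x ∈ J1 F ↔ x 0 = 0 ∧ x 1 = 0 := by
  unfold J1
  rw [Submodule.mem_span_pair]
  constructor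
  · rintro ⟨a, b, rfl⟩
    simp [f1, f2]
  · rintro ⟨h2, h3⟩
    refine ⟨x 2, x 3, ?_⟩
    ext i
    fin_cases i <;> simp [f1, f2, h2, h3]

theorem phi12_invol (x : J F) : phi12 F (phi12 F x) = x := by
  ext i
  fin_cases i <;> simp [phi12]

/-- the family `m_t` is supercommutative, `m₀` is the multiplication of
`(2,2)₇`, and for `t ≠ 0` the map `φ` is a graded algebra isomorphism from `(J, m_t)`
onto `D_t`; hence `(m_t)` is a one-parameter degeneration of the family `D_γ`
to `(2,2)₇`. -/
theorem degeneration_D_to_alg7 :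
    (∀ t : F, IsSuperComm F (mt12 F t)) ∧
    mt12 F 0 = mul7 F ∧
    (∀ t : F, t ≠ 0 → IsGradedIso F (mt12 F t) (mulD F t) (phi12 F)) := by
  refine ⟨?_, ?_, ?_⟩
  · intro t x y dx dy hx hy
    unfold IsHomog at hx hy
    rw [mem_J0_iff, mem_J1_iff] at hx hy
    rcases hx with ⟨rfl, h1, h2⟩ | ⟨rfl, h1, h2⟩ <;>
      rcases hy with ⟨rfl, h3, h4⟩ | ⟨rfl, h3, h4⟩ <;>
      ext i <;> fin_cases i <;> simp [mt12, h1, h2, h3, h4] <;> ring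
  · funext x y
    simp [mt12, mul7]
  · intro t _
    refine ⟨⟨?_, ?_⟩, (Function.Involutive.bijective (phi12_invol F)), ?_, ?_, ?_⟩
    · intro x y
      ext i
      fin_cases i <;> simp [phi12]
    · intro c x
      ext i
      fin_cases i <;> simp [phi12]
    · ext x
      simp only [Set.mem_image, SetLike.mem_coe, mem_J0_iff]
      constructor
      · rintro ⟨y, ⟨h1, h2⟩, rfl⟩
        simp [phi12, h1, h2]
      · rintro ⟨h1, h2⟩
        exact ⟨phi12 F x, by simp [phi12, h1, h2], phi12_invol F x⟩
    · ext x
      simp only [Set.mem_image, SetLike.mem_coe, mem_J1_iff]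
      constructor
      · rintro ⟨y, ⟨h1, h2⟩, rfl⟩
        simp [phi12, h1, h2]
      · rintro ⟨h1, h2⟩
        exact ⟨phi12 F x, by simp [phi12, h1, h2], phi12_invol F x⟩
    · intro x y
      ext i
      fin_cases i <;> simp [phi12, mt12, mulD] <;> ring

end JS22
end
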